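/- Let m ≥ 4 and let N be a finite electorate with |N| ≥ 5 odd. No Condorcet-consistent social decision scheme on N satisfies both weak SD-strategyproofness and weak PC1-strategyproofness. -/

import Mathlib

open scoped Classical
open Finset

noncomputable section

/-- A strict preference relation: a strict linear (total) order on `A`. -/
abbrev Pref (A : Type*) : Type _ := {r : A → A → Prop // IsStrictTotalOrder A r}

/-- A lottery over the finite set `A` of alternatives. -/
def Lottery (A : Type*) [Fintype A] : Type _ :=
  {p : A → ℝ // (∀ x, 0 ≤ p x) ∧ ∑ x : A, p x = 1}

variable {A : Type*} [Fintype A]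

/-- `∑_{x ≻ y} p(x) q(y)`. -/
def PCsum (r : Pref A) (p q : A → ℝ) : ℝ :=
  ∑ x : A, ∑ y : A, if r.val x y then p x * q y else 0

/-- Pairwise-comparison (weak) preference over lotteries: `p ≿^PC q`. -/
def PCge (r : Pref A) (p q : Lottery A) : Prop :=
  PCsum r q.val p.val ≤ PCsum r p.val q.val

/-- Pairwise-comparison strict preference over lotteries: `p ≻^PC q`. -/
def PCgt (r : Pref A) (p q : Lottery A) : Prop :=
  PCsum r q.val p.val < PCsum r p.val q.val

/-- Stochastic dominance (weak) preference `p ≿^SD q`. -/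
def SDge (r : Pref A) (p q : Lottery A) : Prop :=
  ∀ x : A, (∑ y : A, if r.val y x then q.val y else 0) ≤
    (∑ y : A, if r.val y x then p.val y else 0)

/-- Stochastic dominance strict preference `p ≻^SD q`. -/
def SDgt (r : Pref A) (p q : Lottery A) : Prop := SDge r p q ∧ ¬ SDge r q p

/-- A lottery is degenerate if it puts probability 1 on a single alternative. -/
def Degenerate (p : Lottery A) : Prop := ∃ x, p.val x = 1

/-- `p ≿^PC1 q`: PC preference restricted to comparisons with a degenerate lottery. -/
def PC1ge (r : Pref A) (p q : Lottery A) : Prop :=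
  PCge r p q ∧ (Degenerate p ∨ Degenerate q)

/-- `p ≻^PC1 q`. -/
def PC1gt (r : Pref A) (p q : Lottery A) : Prop := PC1ge r p q ∧ ¬ PC1ge r q p

/-- Majority margin `g_R(x,y)`. -/
def margin {I : Type*} [Fintype I] (R : I → Pref A) (x y : A) : ℤ :=
  ((univ.filter fun i => (R i).val x y).card : ℤ) -
    ((univ.filter fun i => (R i).val y x).card : ℤ)

/-- `x` is a Condorcet winner of `R`. -/
def CondorcetWinner {I : Type*} [Fintype I] (R : I → Pref A) (x : A) : Prop :=
  ∀ y, y ≠ x → 0 < margin R x y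

/-- Condorcet-consistency on a fixed electorate. -/
def CondorcetConsistent {N : Type*} [Fintype N] (f : (N → Pref A) → Lottery A) : Prop :=
  ∀ (R : N → Pref A) (x : A), CondorcetWinner R x → (f R).val x = 1

/-- Weak SD-strategyproofness: no voter can obtain a strictly SD-preferred outcome by lying. -/
def WeaklySDStrategyproof {N : Type*} (f : (N → Pref A) → Lottery A) : Prop :=
  ∀ (i : N) (R R' : N → Pref A), (∀ j, j ≠ i → R j = R' j) → ¬ SDgt (R i) (f R') (f R)

/-- Weak PC1-strategyproofness: no voter can obtain a strictly PC1-preferred outcome by lying. -/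
def WeaklyPC1Strategyproof {N : Type*} (f : (N → Pref A) → Lottery A) : Prop :=
  ∀ (i : N) (R R' : N → Pref A), (∀ j, j ≠ i → R j = R' j) → ¬ PC1gt (R i) (f R') (f R)

/-! ### Comparisons with degenerate lotteries -/

/-- A lottery with probability one on `x` vanishes everywhere else. -/
lemma Lottery.eq_single {p : Lottery A} {x : A} (hx : p.val x = 1) :
    p.val = Pi.single x 1 := by
  have hsum := p.property.2
  rw [← Finset.add_sum_erase _ _ (mem_univ x), hx, add_eq_left,
    Finset.sum_eq_zero_iff_of_nonneg fun y _ => p.property.1 y] at hsum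
  funext y
  by_cases hy : y = x
  · subst hy
    simpa using hx
  · simpa [hy] using hsum y (by simp [hy])

lemma PCsum_single_left (r : Pref A) (x : A) (q : A → ℝ) :
    PCsum r (Pi.single x 1) q = ∑ y, if r.val x y then q y else 0 := by
  unfold PCsum
  rw [Finset.sum_eq_single x]
  · simp
  · intro z _ hz
    simp [hz]
  · simp

lemma PCsum_single_right (r : Pref A) (x : A) (p : A → ℝ) :
    PCsum r p (Pi.single x 1) = ∑ y, if r.val y x then p y else 0 := by
  unfold PCsum
  rw [Finset.sum_comm, Finset.sum_eq_single x]
  · simp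
  · intro z _ hz
    simp [hz]
  · simp

lemma PC1gt_of_PCgt {r : Pref A} {p q : Lottery A} (h : PCgt r p q)
    (hd : Degenerate p ∨ Degenerate q) : PC1gt r p q :=
  ⟨⟨le_of_lt h, hd⟩, fun h' => absurd h'.1 (not_le_of_gt h)⟩

/-- If a voter can enforce `x`, then the outcome is at least as likely above `x` as below `x`. -/
lemma WeaklyPC1Strategyproof.below_le_above {N : Type*} {f : (N → Pref A) → Lottery A}
    (hf : WeaklyPC1Strategyproof f) {i : N} {R R' : N → Pref A} (hR : ∀ j, j ≠ i → R j = R' j)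
    {x : A} (hx : (f R').val x = 1) :
    (∑ y, if (R i).val x y then (f R).val y else 0) ≤
      ∑ y, if (R i).val y x then (f R).val y else 0 := by
  by_contra! h
  refine hf i R R' hR (PC1gt_of_PCgt ?_ (Or.inl ⟨x, hx⟩))
  rwa [PCgt, Lottery.eq_single hx, PCsum_single_left, PCsum_single_right]

/-- If a voter can abandon `x`, then the new outcome is at most as likely above `x` as below `x`. -/
lemma WeaklyPC1Strategyproof.above_le_below {N : Type*} {f : (N → Pref A) → Lottery A}
    (hf : WeaklyPC1Strategyproof f) {i : N} {R R' : N → Pref A} (hR : ∀ j, j ≠ i → R j = R' j)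
    {x : A} (hx : (f R).val x = 1) :
    (∑ y, if (R i).val y x then (f R').val y else 0) ≤
      ∑ y, if (R i).val x y then (f R').val y else 0 := by
  by_contra! h
  refine hf i R R' hR (PC1gt_of_PCgt ?_ (Or.inr ⟨x, hx⟩))
  rwa [PCgt, Lottery.eq_single hx, PCsum_single_left, PCsum_single_right]

/-! ### Profiles with five active voters and four active alternatives -/

/-- A ranking of four alternatives; `σ x` is the position of `x`, with `0` the top position. -/
abbrev Ballot : Type := Fin 4 ↪ Fin 4

/-- The position of each alternative when a ballot is extended by placing all others below. -/
def Ballot.position {k : ℕ} (σ : Ballot) : Fin 4 ⊕ Fin k → ℕ :=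
  Sum.elim (fun x => (σ x : ℕ)) fun y => 4 + (y : ℕ)

lemma Ballot.position_injective {k : ℕ} (σ : Ballot) :
    Function.Injective (σ.position : Fin 4 ⊕ Fin k → ℕ) := by
  refine Function.Injective.sumElim (Fin.val_injective.comp σ.injective) ?_ ?_
  · intro x y h
    exact Fin.val_injective (by simpa using h)
  · intro x y
    have := (σ x).isLt
    omega

/-- The preference relation on `A` given by a ballot on the active alternatives. -/
def Ballot.pref {A : Type*} {k : ℕ} (α : A ≃ Fin 4 ⊕ Fin k) (σ : Ballot) : Pref A :=
  ⟨fun x y => σ.position (α x) < σ.position (α y),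
    { irrefl := fun _ => lt_irrefl _
      trans := fun _ _ _ => lt_trans
      trichotomous := fun _ _ h h' =>
        α.injective (σ.position_injective (le_antisymm (not_lt.1 h') (not_lt.1 h))) }⟩

/-- The reverse of a preference relation. -/
def Pref.reverse {A : Type*} (r : Pref A) : Pref A :=
  ⟨Function.swap r.val, haveI := r.property; inferInstance⟩

/-- Five voters submit the given ballots, the others cancel out in pairs. -/
def activeProfile {A N : Type*} {k l : ℕ} (α : A ≃ Fin 4 ⊕ Fin k)
    (φ : N ≃ Fin 5 ⊕ (Fin l ⊕ Fin l)) (v : Fin 5 → Ballot) : N → Pref A := fun i =>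
  Sum.elim (fun j => (v j).pref α)
    (Sum.elim (fun _ => Ballot.pref α (.refl _)) fun _ => (Ballot.pref α (.refl _)).reverse) (φ i)

section activeProfile

variable {N : Type*} {k l : ℕ} (α : A ≃ Fin 4 ⊕ Fin k) (φ : N ≃ Fin 5 ⊕ (Fin l ⊕ Fin l))

lemma activeProfile_active {A : Type*} (α : A ≃ Fin 4 ⊕ Fin k) (v : Fin 5 → Ballot) (j : Fin 5) :
    activeProfile α φ v (φ.symm (.inl j)) = (v j).pref α := by
  simp [activeProfile]

lemma activeProfile_update_of_ne {A : Type*} (α : A ≃ Fin 4 ⊕ Fin k) (v : Fin 5 → Ballot)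
    (j : Fin 5) (σ : Ballot) (i : N) (hi : i ≠ φ.symm (.inl j)) :
    activeProfile α φ v i = activeProfile α φ (Function.update v j σ) i := by
  obtain ⟨i, rfl⟩ := φ.symm.surjective i
  rcases i with i | i
  · have hij : i ≠ j := fun h => hi (by rw [h])
    simp [activeProfile, hij]
  · simp [activeProfile]

lemma card_activeProfile {A : Type*} [Fintype N] (α : A ≃ Fin 4 ⊕ Fin k) (v : Fin 5 → Ballot)
    (x y : A) :
    #{i | (activeProfile α φ v i).val x y} =
      #{j | ((v j).pref α).val x y} + (#{_i : Fin l | (Ballot.pref α (.refl _)).val x y} +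
        #{_i : Fin l | (Ballot.pref α (.refl _)).val y x}) := by
  simp only [Finset.card_filter]
  rw [← φ.symm.sum_comp, Fintype.sum_sum_type, Fintype.sum_sum_type]
  refine congrArg₂ _ ?_ (congrArg₂ _ ?_ ?_) <;>
    exact Finset.sum_congr rfl fun i _ => by simp [activeProfile, Pref.reverse, Function.swap]

lemma margin_activeProfile {A : Type*} [Fintype N] (α : A ≃ Fin 4 ⊕ Fin k) (v : Fin 5 → Ballot)
    (x y : A) :
    margin (activeProfile α φ v) x y =
      #{j | ((v j).pref α).val x y} - #{j | ((v j).pref α).val y x} := by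
  rw [margin, card_activeProfile, card_activeProfile]
  push_cast
  ring

/-- An active alternative that beats every other active one is a Condorcet winner. -/
lemma condorcetWinner_activeProfile {A : Type*} [Fintype N] (α : A ≃ Fin 4 ⊕ Fin k)
    (v : Fin 5 → Ballot) (x : Fin 4)
    (h : ∀ y, y ≠ x → #{j | v j y < v j x} < #{j | v j x < v j y}) :
    CondorcetWinner (activeProfile α φ v) (α.symm (.inl x)) := by
  intro y hy
  obtain ⟨y, rfl⟩ := α.symm.surjective y
  rw [margin_activeProfile, sub_pos, Nat.cast_lt]
  rcases y with y | y
  · have hyx : y ≠ x := fun h => hy (by rw [h])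
    simpa [Ballot.pref, Ballot.position] using h y hyx
  · have hlt : ∀ j, (v j x : ℕ) < 4 + (y : ℕ) := fun j => by omega
    have hnlt : ∀ j, ¬ 4 + (y : ℕ) < (v j x : ℕ) := fun j => by omega
    simp [Ballot.pref, Ballot.position, hlt, hnlt]

lemma sum_below_pref (σ : Ballot) (x : Fin 4) (p : A → ℝ) :
    (∑ y, if (σ.pref α).val (α.symm (.inl x)) y then p y else 0) =
      (∑ y, if σ x < σ y then p (α.symm (.inl y)) else 0) + ∑ y, p (α.symm (.inr y)) := by
  have hlt : ∀ y : Fin k, (σ x : ℕ) < 4 + (y : ℕ) := fun y => by omega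
  rw [← α.symm.sum_comp, Fintype.sum_sum_type]
  simp [Ballot.pref, Ballot.position, hlt]

lemma sum_above_pref (σ : Ballot) (x : Fin 4) (p : A → ℝ) :
    (∑ y, if (σ.pref α).val y (α.symm (.inl x)) then p y else 0) =
      ∑ y, if σ y < σ x then p (α.symm (.inl y)) else 0 := by
  have hnlt : ∀ y : Fin k, ¬ 4 + (y : ℕ) < (σ x : ℕ) := fun y => by omega
  rw [← α.symm.sum_comp, Fintype.sum_sum_type]
  simp [Ballot.pref, Ballot.position, hnlt]

lemma sum_above_pref_inactive (σ : Ballot) (x : Fin k) (p : A → ℝ)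
    (hp : ∀ y : Fin k, p (α.symm (.inr y)) = 0) :
    (∑ y, if (σ.pref α).val y (α.symm (.inr x)) then p y else 0) =
      ∑ y, p (α.symm (.inl y)) := by
  have hlt : ∀ y : Fin 4, (σ y : ℕ) < 4 + (x : ℕ) := fun y => by omega
  rw [← α.symm.sum_comp, Fintype.sum_sum_type]
  simp [Ballot.pref, Ballot.position, hlt, hp]

variable [Fintype N] {f : (N → Pref A) → Lottery A}

/-- If voter `j` can make `x` the Condorcet winner by submitting `σ`, then the outcome is at least
as likely above `x` as below `x` with respect to the true ballot of `j`. -/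
lemma activeProfile_below_le_above (hf : CondorcetConsistent f) (hpc : WeaklyPC1Strategyproof f)
    (v : Fin 5 → Ballot) (j : Fin 5) (σ : Ballot) (x : Fin 4)
    (h : ∀ y, y ≠ x → #{i | Function.update v j σ i y < Function.update v j σ i x} <
      #{i | Function.update v j σ i x < Function.update v j σ i y}) :
    (∑ y, if v j x < v j y then (f (activeProfile α φ v)).val (α.symm (.inl y)) else 0) +
        ∑ y, (f (activeProfile α φ v)).val (α.symm (.inr y)) ≤
      ∑ y, if v j y < v j x then (f (activeProfile α φ v)).val (α.symm (.inl y)) else 0 := by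
  have key := hpc.below_le_above (activeProfile_update_of_ne φ α v j σ)
    (hf _ _ (condorcetWinner_activeProfile φ α _ x h))
  rwa [activeProfile_active, sum_below_pref, sum_above_pref] at key

/-- If `x` would be the Condorcet winner were voter `j` to submit `σ`, then the outcome is at most
as likely above `x` as below `x` with respect to `σ`. -/
lemma activeProfile_above_le_below (hf : CondorcetConsistent f) (hpc : WeaklyPC1Strategyproof f)
    (v : Fin 5 → Ballot) (j : Fin 5) (σ : Ballot) (x : Fin 4)
    (h : ∀ y, y ≠ x → #{i | Function.update v j σ i y < Function.update v j σ i x} <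
      #{i | Function.update v j σ i x < Function.update v j σ i y}) :
    (∑ y, if σ y < σ x then (f (activeProfile α φ v)).val (α.symm (.inl y)) else 0) ≤
      (∑ y, if σ x < σ y then (f (activeProfile α φ v)).val (α.symm (.inl y)) else 0) +
        ∑ y, (f (activeProfile α φ v)).val (α.symm (.inr y)) := by
  have key := hpc.above_le_below
    (fun i hi => (activeProfile_update_of_ne φ α v j σ i hi).symm)
    (hf _ _ (condorcetWinner_activeProfile φ α _ x h))
  rwa [activeProfile_active, Function.update_self, sum_below_pref, sum_above_pref] at key

end activeProfile

lemma Lottery.sum_active {k : ℕ} (α : A ≃ Fin 4 ⊕ Fin k) (p : Lottery A) :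
    ∑ x, p.val (α.symm (.inl x)) + ∑ x, p.val (α.symm (.inr x)) = 1 := by
  rw [← Fintype.sum_sum_type fun x => p.val (α.symm x), α.symm.sum_comp]
  exact p.property.2

/-! ### The two critical profiles

With alternatives `0, 1, 2, 3`, the ballots of the first profile are, from top to bottom,
`0123`, `0213`, `1320`, `2310`, `3012`. In the second profile, the second voter submits `0231`
instead. -/

/-- The ballots of the first critical profile. -/
def firstBallots : Fin 5 → Ballot :=
  ![⟨![0, 1, 2, 3], by decide⟩, ⟨![0, 2, 1, 3], by decide⟩, ⟨![3, 0, 2, 1], by decide⟩,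
    ⟨![3, 2, 0, 1], by decide⟩, ⟨![1, 2, 3, 0], by decide⟩]

/-- The deviation of the second voter that leads to the second critical profile. -/
def deviation : Ballot := ⟨![0, 3, 1, 2], by decide⟩

/-- The ballots of the second critical profile. -/
def secondBallots : Fin 5 → Ballot := Function.update firstBallots 1 deviation

section criticalProfiles

variable {N : Type*} [Fintype N] {k l : ℕ} (α : A ≃ Fin 4 ⊕ Fin k)
  (φ : N ≃ Fin 5 ⊕ (Fin l ⊕ Fin l)) {f : (N → Pref A) → Lottery A}

/-- The first critical profile yields the uniform lottery on `0, 1, 3`. -/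
lemma outcome_firstBallots (hf : CondorcetConsistent f) (hpc : WeaklyPC1Strategyproof f) :
    (∀ x, (f (activeProfile α φ firstBallots)).val (α.symm (.inl x)) =
      (![1 / 3, 1 / 3, 0, 1 / 3] : Fin 4 → ℝ) x) ∧
    ∀ x, (f (activeProfile α φ firstBallots)).val (α.symm (.inr x)) = 0 := by
  have h₁ := activeProfile_above_le_below α φ hf hpc firstBallots 0
    ⟨![0, 2, 3, 1], by decide⟩ 3 (by decide)
  have h₂ := activeProfile_below_le_above α φ hf hpc firstBallots 0
    ⟨![1, 0, 2, 3], by decide⟩ 1 (by decide)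
  have h₃ := activeProfile_below_le_above α φ hf hpc firstBallots 4
    ⟨![0, 1, 2, 3], by decide⟩ 0 (by decide)
  have hsum := (f (activeProfile α φ firstBallots)).sum_active α
  have hnonneg := (f (activeProfile α φ firstBallots)).property.1
  generalize (f (activeProfile α φ firstBallots)).val = p at *
  have hrest : 0 ≤ ∑ x, p (α.symm (.inr x)) := Finset.sum_nonneg fun x _ => hnonneg _
  have hc := hnonneg (α.symm (.inl 2))
  simp [Fin.sum_univ_four, firstBallots] at h₁ h₂ h₃ hsum
  have hzero : ∑ x, p (α.symm (.inr x)) = 0 := by linarith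
  refine ⟨fun x => ?_, fun x => ?_⟩
  · fin_cases x <;> simp <;> linarith
  · exact (Finset.sum_eq_zero_iff_of_nonneg fun x _ => hnonneg _).1 hzero x (mem_univ x)

/-- The second critical profile yields the uniform lottery on `0, 2, 3`. -/
lemma outcome_secondBallots (hf : CondorcetConsistent f) (hpc : WeaklyPC1Strategyproof f) :
    (∀ x, (f (activeProfile α φ secondBallots)).val (α.symm (.inl x)) =
      (![1 / 3, 0, 1 / 3, 1 / 3] : Fin 4 → ℝ) x) ∧
    ∀ x, (f (activeProfile α φ secondBallots)).val (α.symm (.inr x)) = 0 := by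
  have h₁ := activeProfile_above_le_below α φ hf hpc secondBallots 0
    ⟨![0, 1, 3, 2], by decide⟩ 3 (by decide)
  have h₂ := activeProfile_below_le_above α φ hf hpc secondBallots 0
    ⟨![1, 2, 0, 3], by decide⟩ 2 (by decide)
  have h₃ := activeProfile_below_le_above α φ hf hpc secondBallots 4
    ⟨![0, 1, 2, 3], by decide⟩ 0 (by decide)
  have hsum := (f (activeProfile α φ secondBallots)).sum_active α
  have hnonneg := (f (activeProfile α φ secondBallots)).property.1
  generalize (f (activeProfile α φ secondBallots)).val = p at *
  have hrest : 0 ≤ ∑ x, p (α.symm (.inr x)) := Finset.sum_nonneg fun x _ => hnonneg _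
  have hb := hnonneg (α.symm (.inl 1))
  simp [Fin.sum_univ_four, secondBallots, firstBallots] at h₁ h₂ h₃ hsum
  have hzero : ∑ x, p (α.symm (.inr x)) = 0 := by linarith
  refine ⟨fun x => ?_, fun x => ?_⟩
  · fin_cases x <;> simp <;> linarith
  · exact (Finset.sum_eq_zero_iff_of_nonneg fun x _ => hnonneg _).1 hzero x (mem_univ x)

/-- The second voter of the first critical profile benefits from the deviation. -/
lemma SDgt_deviation (hf : CondorcetConsistent f) (hpc : WeaklyPC1Strategyproof f) :
    SDgt ((firstBallots 1).pref α) (f (activeProfile α φ secondBallots))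
      (f (activeProfile α φ firstBallots)) := by
  obtain ⟨hp, hp'⟩ := outcome_firstBallots α φ hf hpc
  obtain ⟨hq, hq'⟩ := outcome_secondBallots α φ hf hpc
  refine ⟨fun x => ?_, fun h => ?_⟩
  · obtain ⟨x, rfl⟩ := α.symm.surjective x
    rcases x with x | x
    · rw [sum_above_pref, sum_above_pref]
      simp only [hp, hq, Fin.sum_univ_four]
      fin_cases x <;> simp [firstBallots]
    · rw [sum_above_pref_inactive α _ _ _ hp', sum_above_pref_inactive α _ _ _ hq']
      simp only [hp, hq, Fin.sum_univ_four]
      simp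
  · have h := h (α.symm (.inl 1))
    rw [sum_above_pref, sum_above_pref] at h
    simp only [hp, hq, Fin.sum_univ_four] at h
    simp [firstBallots] at h
    norm_num at h

end criticalProfiles

/-- For `m ≥ 4` alternatives and a finite electorate of odd size at least 5,
no Condorcet-consistent SDS satisfies both weak SD-strategyproofness and weak
PC1-strategyproofness. -/
theorem no_condorcet_consistent_weakly_sd_and_pc1_strategyproof
    {A N : Type*} [Fintype A] [Fintype N]
    (hm : 4 ≤ Fintype.card A) (hn : 5 ≤ Fintype.card N) (hodd : Odd (Fintype.card N))
    (f : (N → Pref A) → Lottery A) (hf : CondorcetConsistent f) :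
    ¬ (WeaklySDStrategyproof f ∧ WeaklyPC1Strategyproof f) := by
  rintro ⟨hsd, hpc⟩
  obtain ⟨k, hk⟩ := Nat.exists_eq_add_of_le hm
  obtain ⟨l, hl⟩ : ∃ l, Fintype.card N = 5 + (l + l) := by
    obtain ⟨t, ht⟩ := hodd
    exact ⟨t - 2, by omega⟩
  let α : A ≃ Fin 4 ⊕ Fin k := Fintype.equivOfCardEq (by simp [hk])
  let φ : N ≃ Fin 5 ⊕ (Fin l ⊕ Fin l) := Fintype.equivOfCardEq (by simp [hl])
  refine hsd (φ.symm (.inl 1)) (activeProfile α φ firstBallots) (activeProfile α φ secondBallots)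
    (activeProfile_update_of_ne φ α firstBallots 1 deviation) ?_
  rw [activeProfile_active]
  exact SDgt_deviation α φ hf hpc

end
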